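/- R(E_{7,1}) = R(E₇) \ {±Z(E₇)}, where Z(E₇) is the highest root of E₇; consequently |R(E_{7,1})| = 124. -/

import Mathlib

open Finset

/-- Adjacency of the `E₇` Dynkin diagram: chain `E₁—E₂—E₃—E₄—E₅—E₆` (indices
`0,…,5`) with `E₇` (index `6`) attached to `E₃` (index `2`). -/
def E7Adj (i j : Fin 7) : Bool :=
  decide ((i.val + 1 = j.val ∧ j.val ≤ 5) ∨ (j.val + 1 = i.val ∧ i.val ≤ 5) ∨
    (i.val = 6 ∧ j.val = 2) ∨ (j.val = 6 ∧ i.val = 2))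

def E7M (i j : Fin 7) : ℤ :=
  if i = j then -2 else if E7Adj i j then 1 else 0

def E7Q (Y : Fin 7 → ℤ) : ℤ := ∑ i, ∑ j, Y i * E7M i j * Y j

/-- Completing squares in the `E₇` form. -/
lemma E7Q_squares (Y : Fin 7 → ℤ) :
    -12 * E7Q Y = 6 * (2 * Y 0 - Y 1) ^ 2 + 2 * (3 * Y 1 - 2 * Y 2) ^ 2
      + 6 * (2 * Y 5 - Y 4) ^ 2 + 2 * (3 * Y 4 - 2 * Y 3) ^ 2 + (4 * Y 3 - 3 * Y 2) ^ 2
      + 6 * (2 * Y 6 - Y 2) ^ 2 + Y 2 ^ 2 := by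
  have hM : ∀ i j : Fin 7, E7M i j = (!![-2, 1, 0, 0, 0, 0, 0; 1, -2, 1, 0, 0, 0, 0;
      0, 1, -2, 1, 0, 0, 1; 0, 0, 1, -2, 1, 0, 0; 0, 0, 0, 1, -2, 1, 0;
      0, 0, 0, 0, 1, -2, 0; 0, 0, 1, 0, 0, 0, -2] : Matrix (Fin 7) (Fin 7) ℤ) i j := by
    intro i j
    fin_cases i <;> fin_cases j <;> rfl
  simp only [E7Q, Fin.sum_univ_seven, hM]
  simp
  ring

/-- Range of possible coefficients. -/
def coefRange : List ℤ := [-4, -3, -2, -1, 0, 1, 2, 3, 4]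

lemma mem_coefRange {x : ℤ} (h1 : -4 ≤ x) (h2 : x ≤ 4) : x ∈ coefRange := by
  simp only [coefRange, List.mem_cons, List.not_mem_nil, or_false]
  omega

/-- Pruned enumeration of the solutions of `E7Q Y = -2`. -/
def rootList : List (Fin 7 → ℤ) :=
  coefRange.flatMap fun c =>
  (coefRange.filter fun d => (4 * d - 3 * c) ^ 2 + c ^ 2 ≤ 24).flatMap fun d =>
  (coefRange.filter fun b => 2 * (3 * b - 2 * c) ^ 2 + ((4 * d - 3 * c) ^ 2 + c ^ 2) ≤ 24).flatMap
    fun b =>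
  (coefRange.filter fun g => 6 * (2 * g - c) ^ 2 + (2 * (3 * b - 2 * c) ^ 2
    + ((4 * d - 3 * c) ^ 2 + c ^ 2)) ≤ 24).flatMap fun g =>
  (coefRange.filter fun e => 2 * (3 * e - 2 * d) ^ 2 + (6 * (2 * g - c) ^ 2
    + (2 * (3 * b - 2 * c) ^ 2 + ((4 * d - 3 * c) ^ 2 + c ^ 2))) ≤ 24).flatMap fun e =>
  (coefRange.filter fun f => 6 * (2 * f - e) ^ 2 + (2 * (3 * e - 2 * d) ^ 2 + (6 * (2 * g - c) ^ 2
    + (2 * (3 * b - 2 * c) ^ 2 + ((4 * d - 3 * c) ^ 2 + c ^ 2)))) ≤ 24).flatMap fun f =>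
  (coefRange.filter fun a => 6 * (2 * a - b) ^ 2 + (6 * (2 * f - e) ^ 2
    + (2 * (3 * e - 2 * d) ^ 2 + (6 * (2 * g - c) ^ 2
    + (2 * (3 * b - 2 * c) ^ 2 + ((4 * d - 3 * c) ^ 2 + c ^ 2))))) = 24).map fun a =>
  ![a, b, c, d, e, f, g]

lemma mem_rootList_iff (Y : Fin 7 → ℤ) : Y ∈ rootList ↔ E7Q Y = -2 := by
  have key := E7Q_squares Y
  constructor
  · intro h
    simp only [rootList, List.mem_flatMap, List.mem_map, List.mem_filter, decide_eq_true_eq] at h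
    obtain ⟨c, -, d, -, b, -, g, -, e, -, f, -, a, ⟨-, h⟩, rfl⟩ := h
    have k2 : (![a, b, c, d, e, f, g] : Fin 7 → ℤ) 2 = c := rfl
    have k3 : (![a, b, c, d, e, f, g] : Fin 7 → ℤ) 3 = d := rfl
    have k4 : (![a, b, c, d, e, f, g] : Fin 7 → ℤ) 4 = e := rfl
    have k5 : (![a, b, c, d, e, f, g] : Fin 7 → ℤ) 5 = f := rfl
    have k6 : (![a, b, c, d, e, f, g] : Fin 7 → ℤ) 6 = g := rfl
    have k0 : (![a, b, c, d, e, f, g] : Fin 7 → ℤ) 0 = a := rfl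
    have k1 : (![a, b, c, d, e, f, g] : Fin 7 → ℤ) 1 = b := rfl
    rw [k0, k1, k2, k3, k4, k5, k6] at key
    linarith
  · intro h
    rw [h] at key
    have s0 := sq_nonneg (2 * Y 0 - Y 1)
    have s1 := sq_nonneg (3 * Y 1 - 2 * Y 2)
    have s2 := sq_nonneg (2 * Y 5 - Y 4)
    have s3 := sq_nonneg (3 * Y 4 - 2 * Y 3)
    have s4 := sq_nonneg (4 * Y 3 - 3 * Y 2)
    have s5 := sq_nonneg (2 * Y 6 - Y 2)
    have s6 := sq_nonneg (Y 2)
    have bd : ∀ (x : ℤ) (n : ℤ), 0 ≤ n → x ^ 2 < (n + 1) ^ 2 → -n ≤ x ∧ x ≤ n := by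
      intro x n hn hx
      have := abs_lt_of_sq_lt_sq' hx (by omega)
      omega
    have b2 := bd (Y 2) 4 (by norm_num) (by linarith)
    have b3 := bd (4 * Y 3 - 3 * Y 2) 4 (by norm_num) (by linarith)
    have b1 := bd (3 * Y 1 - 2 * Y 2) 3 (by norm_num) (by linarith)
    have b6 := bd (2 * Y 6 - Y 2) 2 (by norm_num) (by linarith)
    have b4 := bd (3 * Y 4 - 2 * Y 3) 3 (by norm_num) (by linarith)
    have b5 := bd (2 * Y 5 - Y 4) 2 (by norm_num) (by linarith)
    have b0 := bd (2 * Y 0 - Y 1) 2 (by norm_num) (by linarith)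
    simp only [rootList, List.mem_flatMap, List.mem_map, List.mem_filter, decide_eq_true_eq]
    refine ⟨Y 2, mem_coefRange (by omega) (by omega),
      Y 3, ⟨mem_coefRange (by omega) (by omega), by linarith⟩,
      Y 1, ⟨mem_coefRange (by omega) (by omega), by linarith⟩,
      Y 6, ⟨mem_coefRange (by omega) (by omega), by linarith⟩,
      Y 4, ⟨mem_coefRange (by omega) (by omega), by linarith⟩,
      Y 5, ⟨mem_coefRange (by omega) (by omega), by linarith⟩,
      Y 0, ⟨mem_coefRange (by omega) (by omega), by linarith⟩, ?_⟩
    funext i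
    fin_cases i <;> rfl

/-- The highest root. -/
def highRoot : Fin 7 → ℤ := ![2, 3, 4, 3, 2, 1, 2]

lemma highRoot_mem : highRoot ∈ rootList := by decide +kernel

lemma highRoot_max : ∀ Y ∈ rootList, (∀ i, highRoot i ≤ Y i) → Y = highRoot := by
  decide +kernel

lemma rootList_small : ∀ Y ∈ rootList, |Y 0| ≤ 1 ↔ ¬ (Y = highRoot ∨ Y = -highRoot) := by
  have h : ∀ Y ∈ rootList, (-1 ≤ Y 0 ∧ Y 0 ≤ 1) ↔
      ¬ (Y = highRoot ∨ Y = fun i => - highRoot i) := by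
    decide +kernel
  intro Y hY
  rw [abs_le]
  exact h Y hY

lemma card_small : ((rootList.filter fun Y => -1 ≤ Y 0 ∧ Y 0 ≤ 1).toFinset).card = 124 := by
  have h1 : (rootList.filter fun Y => -1 ≤ Y 0 ∧ Y 0 ≤ 1).Nodup := by decide +kernel
  rw [List.toFinset_card_of_nodup h1]
  decide +kernel

/-- `R(E_{7,1}) = R(E₇) \ {±Z(E₇)}` where `Z(E₇)` is the highest root of `E₇`, the
modified vertex `E₁` being the end (index `0`) of the length-two arm, whose
coefficient in the highest root is `2`; consequently `|R(E_{7,1})| = 124`.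
Here `R(E_{7,1})` is the set of roots of `E₇` whose `E₁`-coefficient has absolute
value at most `1`. -/
theorem stmt_15 (Z : Fin 7 → ℤ)
    (hZroot : E7Q Z = -2)
    (hZhighest : ∀ Y : Fin 7 → ℤ, E7Q Y = -2 → ∀ i, Y i ≤ Z i) :
    {Y : Fin 7 → ℤ | E7Q Y = -2 ∧ |Y 0| ≤ 1}
      = {Y : Fin 7 → ℤ | E7Q Y = -2} \ {Z, -Z} ∧
    {Y : Fin 7 → ℤ | E7Q Y = -2 ∧ |Y 0| ≤ 1}.ncard = 124 := by
  have hZ : Z = highRoot :=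
    highRoot_max Z ((mem_rootList_iff Z).2 hZroot)
      (hZhighest highRoot ((mem_rootList_iff _).1 highRoot_mem))
  subst hZ
  constructor
  · ext Y
    simp only [Set.mem_ofPred_eq, Set.mem_sdiff, Set.mem_insert_iff, Set.mem_singleton_iff]
    exact and_congr_right fun h => rootList_small Y ((mem_rootList_iff Y).2 h)
  · rw [← card_small, ← Set.ncard_coe_finset]
    congr 1
    ext Y
    simp only [Set.mem_ofPred_eq, List.coe_toFinset, List.mem_filter, decide_eq_true_eq,
      mem_rootList_iff, abs_le]
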